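/- Multi-fluid solutions of the kinetic isothermal Euler system. Let d ≥ 1, T > 0 and n ∈ ℕ. For i = 1,…,n let ρ_i ∈ C¹([0,T] × 𝕋^d) with ρ_i ≥ 0 and Σ_{j=1}^n ρ_j > 0 everywhere, and u_i ∈ C¹([0,T] × 𝕋^d; ℝ^d), solving the multi-fluid kinetic isothermal Euler system: ∂_t ρ_i + ∇_x·(ρ_i u_i) = 0 and ∂_t(ρ_i u_i) + ∇_x·(ρ_i u_i ⊗ u_i) = −ρ_i ∇_x U, where U(t,x) = log Σ_{j=1}^n ρ_j(t,x). For each t define the measure f(t) := Σ_{i=1}^n (x ↦ (x, u_i(t,x)))_# (ρ_i(t,x) dx) on 𝕋^d × ℝ^d. Then f is a distributional solution of the kinetic isothermal Euler system: the spatial marginal of f(t) has density Σ_{j=1}^n ρ_j(t,·) for every t, and for every φ ∈ C_c^∞((0,T) × 𝕋^d × ℝ^d), ∫₀^T ∫_{𝕋^d×ℝ^d} [∂_t φ + v·∇_x φ − ∇_x U(t,x)·∇_v φ](t,x,v) f(t)(dx,dv) dt = 0. -/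

import Mathlib

open MeasureTheory Filter Set
open scoped ENNReal Topology

noncomputable section

/-- The flat `d`-dimensional torus `𝕋^d = ℝ^d/ℤ^d`. -/
abbrev Torus (d : ℕ) := Fin d → AddCircle (1 : ℝ)

/-- The phase space `𝕋^d × ℝ^d`. -/
abbrev Phase (d : ℕ) := Torus d × (Fin d → ℝ)

/-- Canonical projection `ℝ^d → 𝕋^d`. -/
def projT (d : ℕ) (x : Fin d → ℝ) : Torus d := fun i => (x i : AddCircle (1 : ℝ))

/-- The representative in `[0,1)^d` of a point of the torus. -/
def repT (d : ℕ) (y : Torus d) : Fin d → ℝ := fun i => (AddCircle.equivIco 1 0 (y i) : ℝ)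

/-- Fundamental domain `[0,1)^d` of the torus. -/
def Cube (d : ℕ) : Set (Fin d → ℝ) := Set.univ.pi fun _ => Set.Ico (0 : ℝ) 1

/-- `ℤ^d`-periodicity of a function on `ℝ^d` (i.e. the function descends to `𝕋^d`). -/
def ZPeriodic {d : ℕ} {E : Type*} (F : (Fin d → ℝ) → E) : Prop :=
  ∀ (x : Fin d → ℝ) (k : Fin d → ℤ), F (x + fun i => (k i : ℝ)) = F x

/-- The gradient, as the vector of partial derivatives. -/
def gradx {d : ℕ} (g : (Fin d → ℝ) → ℝ) (x : Fin d → ℝ) : Fin d → ℝ :=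
  fun i => fderiv ℝ g x (Pi.single i 1)

/-- The Laplacian, as the sum of the second partial derivatives. -/
def lap {d : ℕ} (g : (Fin d → ℝ) → ℝ) (x : Fin d → ℝ) : ℝ :=
  ∑ i, fderiv ℝ (fun y => fderiv ℝ g y (Pi.single i 1)) x (Pi.single i 1)

/-- The measure on the phase space `𝕋^d × ℝ^d` induced by a (periodic-in-`x`)
density `f(x,v)` on `ℝ^d × ℝ^d`. -/
def measOfDensity (d : ℕ) (f : (Fin d → ℝ) → (Fin d → ℝ) → ℝ) : Measure (Phase d) :=
  Measure.map (fun z : (Fin d → ℝ) × (Fin d → ℝ) => (projT d z.1, z.2))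
    ((((volume : Measure (Fin d → ℝ)).restrict (Cube d)).prod
        (volume : Measure (Fin d → ℝ))).withDensity fun z => ENNReal.ofReal (f z.1 z.2))

/-- Couplings of two measures on the phase space. -/
def couplings (d : ℕ) (μ ν : Measure (Phase d)) : Set (Measure (Phase d × Phase d)) :=
  {π | π.map Prod.fst = μ ∧ π.map Prod.snd = ν}

/-- The Wasserstein distance of order `p` (valued in `ℝ≥0∞`), with respect to the
standard metric on `𝕋^d × ℝ^d`. -/
def Wass (d : ℕ) (p : ℝ) (μ ν : Measure (Phase d)) : ℝ≥0∞ :=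
  ⨅ π ∈ couplings d μ ν, (∫⁻ z, edist z.1 z.2 ^ p ∂π) ^ (1 / p)

/-- Periodization of a function on `ℝ^d` over the lattice `ℤ^d`. -/
def periodize {d : ℕ} (g : (Fin d → ℝ) → ℝ) (x : Fin d → ℝ) : ℝ :=
  ∑' k : Fin d → ℤ, g (x + fun i => (k i : ℝ))

/-- The rescaled charge shape `χ_r(x) = r^{-d} χ(x/r)`. -/
def chiR (d : ℕ) (r : ℝ) (χ : (Fin d → ℝ) → ℝ) (x : Fin d → ℝ) : ℝ :=
  (1 / r ^ d) * χ fun i => x i / r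

/-- Hypotheses on the shape `χ` of an extended charge: smooth, compactly supported,
nonnegative, radially symmetric, with unit mass. -/
def IsChargeShape (d : ℕ) (χ : (Fin d → ℝ) → ℝ) : Prop :=
  ContDiff ℝ (⊤ : ℕ∞) χ ∧ HasCompactSupport χ ∧ (∀ x, 0 ≤ χ x) ∧
    (∀ x y : Fin d → ℝ, (∑ i, x i ^ 2) = (∑ i, y i ^ 2) → χ x = χ y) ∧
    ∫ x, χ x = 1

/-- Time-dependent test functions on `𝕋^d × ℝ^d`: smooth, `ℤ^d`-periodic in `x`,
compactly supported in `v`. -/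
def IsTestXV (d : ℕ) (φ : ℝ → (Fin d → ℝ) → (Fin d → ℝ) → ℝ) : Prop :=
  ContDiff ℝ (⊤ : ℕ∞) (fun p : ℝ × (Fin d → ℝ) × (Fin d → ℝ) => φ p.1 p.2.1 p.2.2) ∧
  (∀ t v, ZPeriodic fun x => φ t x v) ∧
  ∃ R : ℝ, ∀ t x v, R < ‖v‖ → φ t x v = 0

/-- Static test functions on `𝕋^d × ℝ^d`: smooth, `ℤ^d`-periodic in `x`,
compactly supported in `v`. -/
def IsTestXVStatic (d : ℕ) (ψ : (Fin d → ℝ) → (Fin d → ℝ) → ℝ) : Prop :=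
  ContDiff ℝ (⊤ : ℕ∞) (fun p : (Fin d → ℝ) × (Fin d → ℝ) => ψ p.1 p.2) ∧
  (∀ v, ZPeriodic fun x => ψ x v) ∧
  ∃ R : ℝ, ∀ x v, R < ‖v‖ → ψ x v = 0

/-- The integrand of the weak formulation of a Vlasov equation with force field `E`:
`∂_t φ + v · ∇_x φ + E · ∇_v φ`. -/
def vlasovIntegrand (d : ℕ) (E : ℝ → (Fin d → ℝ) → (Fin d → ℝ))
    (φ : ℝ → (Fin d → ℝ) → (Fin d → ℝ) → ℝ) (t : ℝ) (x v : Fin d → ℝ) : ℝ :=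
  deriv (fun s => φ s x v) t + fderiv ℝ (fun y => φ t y v) x v
    + fderiv ℝ (fun w => φ t x w) v (E t x)

/-- `U` is a weak solution of the (scaled) Poisson–Boltzmann equation
`ε² ΔU = e^U − h` on the torus, with source `h`. -/
def IsWeakPB (d : ℕ) (ε : ℝ) (U : (Fin d → ℝ) → ℝ) (h : (Fin d → ℝ) → ℝ) : Prop :=
  ∀ φ : (Fin d → ℝ) → ℝ, ContDiff ℝ (⊤ : ℕ∞) φ → ZPeriodic φ →
    ε ^ 2 * ∫ x in Cube d, U x * lap φ x = ∫ x in Cube d, (Real.exp (U x) - h x) * φ x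

/-- `f` is a bounded-density weak solution of the scaled Vlasov–Poisson system with
massless electrons `(VPME)_ε` on the time interval `[0,T)`, with initial datum `f₀`
(`ε = 1` is the unscaled VPME system). -/
structure IsVPMESolOn (d : ℕ) (ε : ℝ) (f₀ : (Fin d → ℝ) → (Fin d → ℝ) → ℝ)
    (f : ℝ → (Fin d → ℝ) → (Fin d → ℝ) → ℝ) (T : ℝ) : Prop where
  nonneg : ∀ t x v, 0 ≤ f t x v
  periodic : ∀ t v, ZPeriodic fun x => f t x v
  mass : ∀ t ∈ Icc 0 T, ∫ x in Cube d, ∫ v, f t x v = 1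
  boundedDensity : ∀ T' ∈ Ico 0 T, ∃ M : ℝ, ∀ t ∈ Icc 0 T', ∀ x, (∫ v, f t x v) ≤ M
  field : ∃ U : ℝ → (Fin d → ℝ) → ℝ,
    (∀ t, ZPeriodic (U t)) ∧ (∀ t, ContDiff ℝ 1 (U t)) ∧
    (∀ t ∈ Icc 0 T, IsWeakPB d ε (U t) fun x => ∫ v, f t x v) ∧
    (∀ φ : ℝ → (Fin d → ℝ) → (Fin d → ℝ) → ℝ, IsTestXV d φ →
      (∃ b, b < T ∧ ∀ t x v, b ≤ t → φ t x v = 0) →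
      (∫ t in Ioi (0 : ℝ), ∫ x in Cube d, ∫ v,
          vlasovIntegrand d (fun t x => -gradx (U t) x) φ t x v * f t x v)
        + (∫ x in Cube d, ∫ v, φ 0 x v * f₀ x v) = 0)

/-- `g` is a measure-valued distributional solution of the kinetic isothermal Euler
system on `[0,T)`, with initial datum `g₀`. -/
structure IsKIsESolOn (d : ℕ) (g₀ : Measure (Phase d)) (g : ℝ → Measure (Phase d))
    (T : ℝ) : Prop where
  prob : ∀ t ∈ Icc 0 T, IsProbabilityMeasure (g t)
  density : ∃ ρ : ℝ → (Fin d → ℝ) → ℝ,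
    (∀ t ∈ Icc 0 T, ZPeriodic (ρ t) ∧ ContDiff ℝ 1 (ρ t) ∧ ∀ x, 0 < ρ t x) ∧
    (∀ t ∈ Icc 0 T, (g t).map Prod.fst =
      (((volume : Measure (Fin d → ℝ)).restrict (Cube d)).withDensity
          fun x => ENNReal.ofReal (ρ t x)).map (projT d)) ∧
    (∀ φ : ℝ → (Fin d → ℝ) → (Fin d → ℝ) → ℝ, IsTestXV d φ →
      (∃ b, b < T ∧ ∀ t x v, b ≤ t → φ t x v = 0) →
      (∫ t in Ioi (0 : ℝ), ∫ z, vlasovIntegrand d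
          (fun t x => -gradx (fun y => Real.log (ρ t y)) x) φ t (repT d z.1) z.2 ∂(g t))
        + (∫ z, φ 0 (repT d z.1) z.2 ∂g₀) = 0)

/-- The extended-ion dynamics: `N` extended charges of shape `χ_r` interacting through
the (scaled) Poisson–Boltzmann coupling with parameter `ε` (`ε = 1` is unscaled). -/
def IsExtIonSol (d N : ℕ) (ε r : ℝ) (χ : (Fin d → ℝ) → ℝ)
    (X V : ℝ → Fin N → (Fin d → ℝ)) : Prop :=
  ∃ U : ℝ → (Fin d → ℝ) → ℝ,
    (∀ t, ZPeriodic (U t)) ∧ (∀ t, ContDiff ℝ 1 (U t)) ∧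
    (∀ t, IsWeakPB d ε (U t)
      fun x => (N : ℝ)⁻¹ * ∑ j, periodize (chiR d r χ) (x - X t j)) ∧
    (∀ t, ∀ i,
      HasDerivAt (fun s => X s i) (V t i) t ∧
      HasDerivAt (fun s => V s i) (-∫ y, chiR d r χ y • gradx (U t) (X t i - y)) t)

/-- Empirical measure of the `N`-particle configuration at time `t`, as a measure on
the phase space `𝕋^d × ℝ^d`. -/
def empMeas (d N : ℕ) (X V : ℝ → Fin N → (Fin d → ℝ)) (t : ℝ) : Measure (Phase d) :=
  (N : ℝ≥0∞)⁻¹ • ∑ i, Measure.dirac (projT d (X t i), V t i)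

/-- The analytic norm `‖h‖_{B_δ} = Σ_k |ĥ(k)| δ^{|k|}` (valued in `ℝ≥0∞`). -/
def Bnorm (d : ℕ) (δ : ℝ) (h : (Fin d → ℝ) → ℝ) : ℝ≥0∞ :=
  ∑' k : Fin d → ℤ,
    (‖∫ x in Cube d, Complex.exp (-2 * Real.pi * Complex.I * ∑ i, (k i : ℂ) * (x i : ℂ))
        * (h x : ℂ)‖₊ : ℝ≥0∞) * ENNReal.ofReal (δ ^ ∑ i, (k i).natAbs)

/-- The energy of the scaled VPME system:
`½∫|v|²f + (ε²/2)∫|∇U|² + ∫U e^U`. -/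
def vpmeEnergy (d : ℕ) (ε : ℝ) (f : (Fin d → ℝ) → (Fin d → ℝ) → ℝ)
    (U : (Fin d → ℝ) → ℝ) : ℝ :=
  (1 / 2) * (∫ x in Cube d, ∫ v, (∑ i, v i ^ 2) * f x v)
    + (ε ^ 2 / 2) * (∫ x in Cube d, ∑ i, fderiv ℝ U x (Pi.single i 1) ^ 2)
    + ∫ x in Cube d, U x * Real.exp (U x)

section Torus

variable {d : ℕ}

lemma repT_projT {x : Fin d → ℝ} (hx : x ∈ Cube d) : repT d (projT d x) = x := by
  funext i
  have hi : x i ∈ Ico (0 : ℝ) (0 + 1) := by simpa using hx i (mem_univ i)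
  exact AddCircle.equivIco_coe_of_mem hi

lemma measurable_projT : Measurable (projT d) :=
  measurable_pi_iff.2 fun i => AddCircle.measurable_mk'.comp (measurable_pi_apply i)

lemma measurable_repT : Measurable (repT d) :=
  measurable_pi_iff.2 fun i => measurable_subtype_coe.comp
    ((AddCircle.measurableEquivIco 1 0).measurable.comp (measurable_pi_apply i))

lemma measurableSet_Cube : MeasurableSet (Cube d) :=
  MeasurableSet.univ_pi fun _ => measurableSet_Ico

lemma Cube_subset_Icc : Cube d ⊆ Icc 0 1 := fun _ hx =>
  ⟨fun i => (hx i (mem_univ i)).1, fun i => (hx i (mem_univ i)).2.le⟩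

lemma Cube_ae_eq_Icc : Cube d =ᵐ[volume] Icc (0 : Fin d → ℝ) 1 :=
  Measure.univ_pi_Ico_ae_eq_Icc (f := (0 : Fin d → ℝ)) (g := 1)

lemma integrableOn_Cube {F : (Fin d → ℝ) → ℝ} (hF : Continuous F) : IntegrableOn F (Cube d) :=
  (hF.continuousOn.integrableOn_compact isCompact_Icc).mono_set Cube_subset_Icc

lemma ZPeriodic.insertNth_one_eq {m : ℕ} {E : Type*} {F : (Fin (m + 1) → ℝ) → E}
    (hF : ZPeriodic F) (i : Fin (m + 1)) (y : Fin m → ℝ) :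
    F (i.insertNth 1 y) = F (i.insertNth 0 y) := by
  rw [← hF (i.insertNth (0 : ℝ) y) (Pi.single i 1)]
  congr 1
  funext j
  rcases Fin.eq_self_or_eq_succAbove i j with rfl | ⟨k, rfl⟩ <;> simp

/-- The divergence of a periodic `C¹` field integrates to zero over the torus. -/
lemma integral_div_eq_zero (hd : 1 ≤ d) {G : Fin d → (Fin d → ℝ) → ℝ}
    (hG : ∀ k, ContDiff ℝ 1 (G k)) (hper : ∀ k, ZPeriodic (G k)) :
    ∫ x in Cube d, ∑ k, fderiv ℝ (G k) x (Pi.single k 1) = 0 := by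
  obtain ⟨m, rfl⟩ : ∃ m, d = m + 1 := ⟨d - 1, by omega⟩
  rw [setIntegral_congr_set Cube_ae_eq_Icc,
    integral_divergence_of_hasFDerivAt_off_countable' 0 1 zero_le_one G (fun k => fderiv ℝ (G k)) ∅
      countable_empty (fun k => (hG k).continuous.continuousOn)
      (fun x _ k => ((hG k).differentiable one_ne_zero x).hasFDerivAt)]
  · refine Finset.sum_eq_zero fun i _ => ?_
    simp [(hper i).insertNth_one_eq]
  · refine Continuous.continuousOn ?_ |>.integrableOn_compact isCompact_Icc
    exact continuous_finsetSum _ fun k _ =>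
      ((hG k).continuous_fderiv one_ne_zero).clm_apply continuous_const

/-- The time derivative of a `C¹` function vanishing at both ends of `[0,T]` has zero
space-time integral. -/
lemma integral_deriv_eq_zero {T : ℝ} (hT : 0 ≤ T) {F : ℝ → (Fin d → ℝ) → ℝ}
    (hF : ContDiff ℝ 1 fun p : ℝ × (Fin d → ℝ) => F p.1 p.2)
    (h0 : ∀ x, F 0 x = 0) (hT0 : ∀ x, F T x = 0) :
    ∫ t in Ioo 0 T, ∫ x in Cube d, deriv (fun s => F s x) t = 0 := by
  have hsec : ∀ t x, HasDerivAt (fun s => F s x)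
      (fderiv ℝ (fun p : ℝ × (Fin d → ℝ) => F p.1 p.2) (t, x) (1, 0)) t := fun t x =>
    HasFDerivAt.comp_hasDerivAt t (f := fun s => (s, x))
      (hF.differentiable one_ne_zero (t, x)).hasFDerivAt ((hasDerivAt_id t).prodMk (hasDerivAt_const t x))
  have hcont : Continuous fun p : ℝ × (Fin d → ℝ) => deriv (fun s => F s p.2) p.1 := by
    simp_rw [fun p : ℝ × (Fin d → ℝ) => (hsec p.1 p.2).deriv]
    exact (hF.continuous_fderiv one_ne_zero).clm_apply continuous_const
  rw [integral_integral_swap]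
  · refine integral_eq_zero_of_ae (ae_of_all _ fun x => ?_)
    have hc : Continuous fun t => deriv (fun s => F s x) t :=
      hcont.comp (continuous_id.prodMk continuous_const)
    change ∫ t in Ioo 0 T, deriv (fun s => F s x) t = 0
    rw [← integral_Ioc_eq_integral_Ioo, ← intervalIntegral.integral_of_le hT,
      intervalIntegral.integral_deriv_eq_sub (fun t _ => (hsec t x).differentiableAt)
        (hc.intervalIntegrable _ _), h0, hT0, sub_zero]
  · rw [Measure.prod_restrict]
    exact (hcont.continuousOn.integrableOn_compact (isCompact_Icc.prod isCompact_Icc)).mono_set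
      (prod_mono Ioo_subset_Icc_self Cube_subset_Icc)

end Torus

/-- If `(r, w)` satisfies the continuity and momentum equations at `(t, x)` with force `-W`, then
the Vlasov integrand along the graph of `w`, weighted by `r`, is a space-time divergence. -/
lemma mul_vlasovIntegrand_eq_divergence {d : ℕ} {r : ℝ → (Fin d → ℝ) → ℝ}
    {w : ℝ → (Fin d → ℝ) → (Fin d → ℝ)} {W : ℝ → (Fin d → ℝ) → (Fin d → ℝ)}
    {φ : ℝ → (Fin d → ℝ) → (Fin d → ℝ) → ℝ} {t : ℝ} {x : Fin d → ℝ}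
    (hrt : DifferentiableAt ℝ (fun s => r s x) t) (hrx : DifferentiableAt ℝ (r t) x)
    (hwt : DifferentiableAt ℝ (fun s => w s x) t) (hwx : DifferentiableAt ℝ (w t) x)
    (hφ : DifferentiableAt ℝ (fun p : ℝ × (Fin d → ℝ) × (Fin d → ℝ) => φ p.1 p.2.1 p.2.2)
      (t, x, w t x))
    (hcty : deriv (fun s => r s x) t
      + ∑ k, fderiv ℝ (fun y => r t y * w t y k) x (Pi.single k 1) = 0)
    (hmom : ∀ j, deriv (fun s => r s x * w s x j) t
      + ∑ k, fderiv ℝ (fun y => r t y * w t y k * w t y j) x (Pi.single k 1)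
        = -(r t x) * W t x j) :
    r t x * vlasovIntegrand d (fun t x => -W t x) φ t x (w t x)
      = deriv (fun s => r s x * φ s x (w s x)) t
        + ∑ k, fderiv ℝ (fun y => r t y * w t y k * φ t y (w t y)) x (Pi.single k 1) := by
  set L := fderiv ℝ (fun p : ℝ × (Fin d → ℝ) × (Fin d → ℝ) => φ p.1 p.2.1 p.2.2) (t, x, w t x)
    with hL
  have hφL := hφ.hasFDerivAt
  rw [← hL] at hφL
  set wt := deriv (fun s => w s x) t
  set Dw := fderiv ℝ (w t) x
  set Dr := fderiv ℝ (r t) x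
  set rt := deriv (fun s => r s x) t
  have Hrt : HasDerivAt (fun s => r s x) rt t := hrt.hasDerivAt
  have Hrx : HasFDerivAt (r t) Dr x := hrx.hasFDerivAt
  have Hwt : HasDerivAt (fun s => w s x) wt t := hwt.hasDerivAt
  have Hwx : HasFDerivAt (w t) Dw x := hwx.hasFDerivAt
  have Hwtj : ∀ j, HasDerivAt (fun s => w s x j) (wt j) t := hasDerivAt_pi.1 Hwt
  have Hwxj : ∀ j, HasFDerivAt (fun y => w t y j) ((ContinuousLinearMap.proj j).comp Dw) x :=
    fun j => hasFDerivAt_pi'.1 Hwx j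
  -- derivatives of `φ` in each variable, and along the graph of `w`
  have e1 : HasDerivAt (fun s => φ s x (w t x)) (L (1, 0, 0)) t :=
    HasFDerivAt.comp_hasDerivAt t (f := fun s => (s, x, w t x)) hφL ((hasDerivAt_id t).prodMk (hasDerivAt_const t (x, w t x)))
  have e2 : HasFDerivAt (fun y => φ t y (w t x))
      (L.comp ((0 : (Fin d → ℝ) →L[ℝ] ℝ).prod ((ContinuousLinearMap.id ℝ _).prod 0))) x :=
    HasFDerivAt.comp x (f := fun y => (t, y, w t x)) hφL ((hasFDerivAt_const t x).prodMk
      ((hasFDerivAt_id x).prodMk (hasFDerivAt_const (w t x) x)))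
  have e3 : HasFDerivAt (fun v => φ t x v)
      (L.comp ((0 : (Fin d → ℝ) →L[ℝ] ℝ).prod
        ((0 : (Fin d → ℝ) →L[ℝ] (Fin d → ℝ)).prod (ContinuousLinearMap.id ℝ _)))) (w t x) :=
    HasFDerivAt.comp (w t x) (f := fun v => (t, x, v)) hφL ((hasFDerivAt_const t (w t x)).prodMk
      ((hasFDerivAt_const x (w t x)).prodMk (hasFDerivAt_id (w t x))))
  have e4 : HasDerivAt (fun s => φ s x (w s x)) (L (1, 0, wt)) t :=
    HasFDerivAt.comp_hasDerivAt t (f := fun s => (s, x, w s x)) hφL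
      ((hasDerivAt_id t).prodMk ((hasDerivAt_const t x).prodMk Hwt))
  have e5 : HasFDerivAt (fun y => φ t y (w t y))
      (L.comp ((0 : (Fin d → ℝ) →L[ℝ] ℝ).prod ((ContinuousLinearMap.id ℝ _).prod Dw))) x :=
    HasFDerivAt.comp x (f := fun y => (t, y, w t y)) hφL ((hasFDerivAt_const t x).prodMk
      ((hasFDerivAt_id x).prodMk Hwx))
  have split : ∀ (a : ℝ) (y v : Fin d → ℝ),
      L (a, y, v) = a * L (1, 0, 0) + L (0, y, 0) + L (0, 0, v) := fun a y v => by
    rw [← smul_eq_mul, ← map_smul, ← map_add, ← map_add]; simp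
  set A : (Fin d → ℝ) →L[ℝ] ℝ := L.comp ((0 : (Fin d → ℝ) →L[ℝ] ℝ).prod
        ((0 : (Fin d → ℝ) →L[ℝ] (Fin d → ℝ)).prod (ContinuousLinearMap.id ℝ _))) with hA
  set B : (Fin d → ℝ) →L[ℝ] ℝ := L.comp ((0 : (Fin d → ℝ) →L[ℝ] ℝ).prod
    ((ContinuousLinearMap.id ℝ _).prod 0)) with hB
  have hA' : ∀ v, L (0, 0, v) = A v := fun v => by simp [hA]
  have hB' : ∀ y, L (0, y, 0) = B y := fun y => by simp [hB]
  have hrw : ∀ k, HasFDerivAt (fun y => r t y * w t y k)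
      (r t x • (ContinuousLinearMap.proj k).comp Dw + w t x k • Dr) x := fun k => Hrx.mul (Hwxj k)
  have c1 : rt + ∑ k, (r t x * Dw (Pi.single k 1) k + w t x k * Dr (Pi.single k 1)) = 0 := by
    rw [← hcty]
    congr 1
    refine Finset.sum_congr rfl fun k _ => ?_
    rw [(hrw k).fderiv]; simp
  have c2 : ∀ j, r t x * wt j + ∑ k, r t x * w t x k * Dw (Pi.single k 1) j
      = -(r t x) * W t x j := fun j => by
    have hsum : ∑ k, fderiv ℝ (fun y => r t y * w t y k * w t y j) x (Pi.single k 1)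
        = w t x j * (∑ k, (r t x * Dw (Pi.single k 1) k + w t x k * Dr (Pi.single k 1)))
          + ∑ k, r t x * w t x k * Dw (Pi.single k 1) j := by
      rw [Finset.mul_sum, ← Finset.sum_add_distrib]
      refine Finset.sum_congr rfl fun k _ => ?_
      rw [((hrw k).fun_mul (Hwxj j)).fderiv]
      simp
      ring
    rw [← hmom j, (Hrt.fun_mul (Hwtj j)).deriv, hsum]
    linear_combination (-(w t x j)) * c1
  have c3 : r t x * A wt + ∑ k, r t x * w t x k * A (Dw (Pi.single k 1))
      = -(r t x) * A (W t x) := by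
    simp_rw [← smul_eq_mul (_ * _), ← smul_eq_mul (r t x), ← smul_eq_mul (-(r t x)), ← map_smul,
      ← map_sum, ← map_add]
    congr 1
    funext j
    simpa using c2 j
  have c4 : B (w t x) = ∑ k, w t x k * B (Pi.single k 1) := by
    conv_lhs => rw [pi_eq_sum_univ' (w t x)]
    simp only [map_sum, map_smul, smul_eq_mul]
  have hsum : ∑ k, fderiv ℝ (fun y => r t y * w t y k * φ t y (w t y)) x (Pi.single k 1)
      = φ t x (w t x) * (∑ k, (r t x * Dw (Pi.single k 1) k + w t x k * Dr (Pi.single k 1)))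
        + r t x * (∑ k, w t x k * B (Pi.single k 1))
        + ∑ k, r t x * w t x k * A (Dw (Pi.single k 1)) := by
    rw [Finset.mul_sum, Finset.mul_sum, ← Finset.sum_add_distrib, ← Finset.sum_add_distrib]
    refine Finset.sum_congr rfl fun k _ => ?_
    have hk : L (0, Pi.single k 1, Dw (Pi.single k 1))
        = B (Pi.single k 1) + A (Dw (Pi.single k 1)) := by
      rw [split, hA', hB']; ring
    rw [((hrw k).fun_mul e5).fderiv]
    simp [hk]
    ring
  rw [(Hrt.fun_mul e4).deriv, hsum, vlasovIntegrand, e1.deriv, e2.fderiv, e3.fderiv, map_neg, c4,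
    split 1 0 wt, hA' wt, hB' 0, map_zero]
  linear_combination -c3 - φ t x (w t x) * c1

/-- The Vlasov integrand is continuous in phase space when the force is. -/
lemma continuous_vlasovIntegrand {d : ℕ} {E : ℝ → (Fin d → ℝ) → (Fin d → ℝ)}
    {φ : ℝ → (Fin d → ℝ) → (Fin d → ℝ) → ℝ} {t : ℝ}
    (hφ : ContDiff ℝ 1 fun p : ℝ × (Fin d → ℝ) × (Fin d → ℝ) => φ p.1 p.2.1 p.2.2)
    (hE : Continuous (E t)) :
    Continuous fun p : (Fin d → ℝ) × (Fin d → ℝ) => vlasovIntegrand d E φ t p.1 p.2 := by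
  set D := fderiv ℝ fun p : ℝ × (Fin d → ℝ) × (Fin d → ℝ) => φ p.1 p.2.1 p.2.2
  have hφL : ∀ p, HasFDerivAt (fun p : ℝ × (Fin d → ℝ) × (Fin d → ℝ) => φ p.1 p.2.1 p.2.2)
      (D p) p := fun p => (hφ.differentiable one_ne_zero p).hasFDerivAt
  have hDc : Continuous fun p : (Fin d → ℝ) × (Fin d → ℝ) => D (t, p.1, p.2) :=
    (hφ.continuous_fderiv one_ne_zero).comp (by fun_prop)
  have e1 : ∀ x v, deriv (fun s => φ s x v) t = D (t, x, v) (1, 0, 0) := fun x v =>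
    (HasFDerivAt.comp_hasDerivAt t (f := fun s => (s, x, v)) (hφL _)
      ((hasDerivAt_id t).prodMk (hasDerivAt_const t (x, v)))).deriv
  have e2 : ∀ x v y, fderiv ℝ (fun y => φ t y v) x y = D (t, x, v) (0, y, 0) := fun x v y =>
    congrArg (· y) (HasFDerivAt.comp x (f := fun y => (t, y, v)) (hφL _)
      ((hasFDerivAt_const t x).prodMk
        ((hasFDerivAt_id x).prodMk (hasFDerivAt_const v x)))).fderiv
  have e3 : ∀ x v y, fderiv ℝ (fun w => φ t x w) v y = D (t, x, v) (0, 0, y) := fun x v y =>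
    congrArg (· y) (HasFDerivAt.comp v (f := fun v => (t, x, v)) (hφL _)
      ((hasFDerivAt_const t v).prodMk
        ((hasFDerivAt_const x v).prodMk (hasFDerivAt_id v)))).fderiv
  simp_rw [vlasovIntegrand, e1, e2, e3]
  exact ((hDc.clm_apply (by fun_prop)).add (hDc.clm_apply (by fun_prop))).add
    (hDc.clm_apply (by fun_prop))

section GraphMeasure

variable {d : ℕ} {r : (Fin d → ℝ) → ℝ} {w : (Fin d → ℝ) → (Fin d → ℝ)}
  {G : (Fin d → ℝ) → (Fin d → ℝ) → ℝ}

lemma aestronglyMeasurable_comp_repT (μ : Measure (Phase d))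
    (hG : Continuous fun p : (Fin d → ℝ) × (Fin d → ℝ) => G p.1 p.2) :
    AEStronglyMeasurable (fun z : Phase d => G (repT d z.1) z.2) μ :=
  (hG.measurable.comp
    ((measurable_repT.comp measurable_fst).prodMk measurable_snd)).aestronglyMeasurable

/-- Continuous functions on phase space are integrable against a measure carried by a graph. -/
lemma integrable_map_graph (hr : Continuous r) (hw : Continuous w) (hr0 : ∀ x, 0 ≤ r x)
    (hG : Continuous fun p : (Fin d → ℝ) × (Fin d → ℝ) => G p.1 p.2) :
    Integrable (fun z : Phase d => G (repT d z.1) z.2)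
      (Measure.map (fun x => (projT d x, w x))
        ((volume.restrict (Cube d)).withDensity fun x => ENNReal.ofReal (r x))) := by
  rw [integrable_map_measure (aestronglyMeasurable_comp_repT _ hG)
    (measurable_projT.prodMk hw.measurable).aemeasurable,
    integrable_withDensity_iff_integrable_smul' hr.measurable.ennreal_ofReal
      (ae_of_all _ fun _ => ENNReal.ofReal_lt_top)]
  refine IntegrableOn.congr_fun (f := fun x => r x * G x (w x)) (integrableOn_Cube ?_) ?_
    measurableSet_Cube
  · exact hr.mul (hG.comp (continuous_id.prodMk hw))
  · intro x hx
    simp [repT_projT hx, ENNReal.toReal_ofReal (hr0 x)]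

/-- Integration against a measure carried by a graph. -/
lemma integral_map_graph (hr : Continuous r) (hw : Continuous w) (hr0 : ∀ x, 0 ≤ r x)
    (hG : Continuous fun p : (Fin d → ℝ) × (Fin d → ℝ) => G p.1 p.2) :
    ∫ z, G (repT d z.1) z.2 ∂(Measure.map (fun x => (projT d x, w x))
        ((volume.restrict (Cube d)).withDensity fun x => ENNReal.ofReal (r x)))
      = ∫ x in Cube d, r x * G x (w x) := by
  rw [integral_map (measurable_projT.prodMk hw.measurable).aemeasurable
      (aestronglyMeasurable_comp_repT _ hG),
    integral_withDensity_eq_integral_toReal_smul hr.measurable.ennreal_ofReal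
      (ae_of_all _ fun _ => ENNReal.ofReal_lt_top)]
  refine setIntegral_congr_fun measurableSet_Cube fun x hx => ?_
  simp [repT_projT hx, ENNReal.toReal_ofReal (hr0 x)]

/-- The spatial marginal of a sum of measures carried by graphs. -/
lemma map_fst_sum_map_graph {ι : Type*} [Fintype ι] {r : ι → (Fin d → ℝ) → ℝ}
    {w : ι → (Fin d → ℝ) → (Fin d → ℝ)} (hr : ∀ i, Continuous (r i)) (hw : ∀ i, Continuous (w i))
    (hr0 : ∀ i x, 0 ≤ r i x) :
    (∑ i, Measure.map (fun x => (projT d x, w i x))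
        ((volume.restrict (Cube d)).withDensity fun x => ENNReal.ofReal (r i x))).map Prod.fst
      = ((volume.restrict (Cube d)).withDensity
          fun x => ENNReal.ofReal (∑ i, r i x)).map (projT d) := by
  have hsum : (volume.restrict (Cube d)).withDensity (fun x => ENNReal.ofReal (∑ i, r i x))
      = ∑ i, (volume.restrict (Cube d)).withDensity fun x => ENNReal.ofReal (r i x) := by
    ext s hs
    simp_rw [Measure.finsetSum_apply, withDensity_apply _ hs,
      ENNReal.ofReal_sum_of_nonneg fun i _ => hr0 i _]
    exact lintegral_finsetSum _ fun i _ => (hr i).measurable.ennreal_ofReal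
  rw [hsum, Measure.map_finset_sum measurable_fst.aemeasurable,
    Measure.map_finset_sum measurable_projT.aemeasurable]
  refine Finset.sum_congr rfl fun i _ => ?_
  rw [Measure.map_map measurable_fst (measurable_projT.prodMk (hw i).measurable)]
  rfl

end GraphMeasure

/-- **Multi-fluid solutions of the kinetic isothermal Euler system.**
If `(ρ_i, u_i)_{i=1}^n` is a `C¹` solution of the multi-fluid kinetic isothermal Euler
system, then `f = Σ_i ρ_i δ₀(v − u_i)` is a distributional solution of the kinetic
isothermal Euler system. -/
theorem multifluid_solution_KIsE
    (d : ℕ) (hd : 1 ≤ d) (T : ℝ) (hT : 0 < T) (n : ℕ) (hn : 1 ≤ n)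
    (ρ : Fin n → ℝ → (Fin d → ℝ) → ℝ) (u : Fin n → ℝ → (Fin d → ℝ) → (Fin d → ℝ))
    -- regularity, periodicity, nonnegativity, total positivity
    (hρC1 : ∀ i, ContDiff ℝ 1 fun p : ℝ × (Fin d → ℝ) => ρ i p.1 p.2)
    (huC1 : ∀ i, ContDiff ℝ 1 fun p : ℝ × (Fin d → ℝ) => u i p.1 p.2)
    (hρper : ∀ i t, ZPeriodic (ρ i t)) (huper : ∀ i t, ZPeriodic (u i t))
    (hρnn : ∀ i t x, 0 ≤ ρ i t x) (hρpos : ∀ t x, 0 < ∑ j, ρ j t x)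
    -- the multi-fluid system on `[0,T]`, with `U = log Σ_j ρ_j`: continuity equations
    (heq1 : ∀ i, ∀ t ∈ Icc (0:ℝ) T, ∀ x,
      deriv (fun s => ρ i s x) t
        + ∑ k, fderiv ℝ (fun y => ρ i t y * u i t y k) x (Pi.single k 1) = 0)
    -- momentum equations
    (heq2 : ∀ i, ∀ t ∈ Icc (0:ℝ) T, ∀ x, ∀ j,
      deriv (fun s => ρ i s x * u i s x j) t
        + (∑ k, fderiv ℝ (fun y => ρ i t y * u i t y k * u i t y j) x (Pi.single k 1))
        = -(ρ i t x) *
            fderiv ℝ (fun y => Real.log (∑ j', ρ j' t y)) x (Pi.single j 1))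
    -- `f t = Σ_i (x ↦ (x, u_i(t,x)))_#(ρ_i(t,x) dx)`
    (f : ℝ → Measure (Phase d))
    (hf : ∀ t, f t = ∑ i, Measure.map (fun x => (projT d x, u i t x))
      (((volume : Measure (Fin d → ℝ)).restrict (Cube d)).withDensity
        fun x => ENNReal.ofReal (ρ i t x))) :
    -- the spatial marginal of `f t` has density `Σ_j ρ_j(t,·)`
    (∀ t ∈ Icc (0:ℝ) T, (f t).map Prod.fst =
      ((((volume : Measure (Fin d → ℝ))).restrict (Cube d)).withDensity
          fun x => ENNReal.ofReal (∑ j, ρ j t x)).map (projT d)) ∧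
    -- `f` solves KIsE in the sense of distributions on `(0,T) × 𝕋^d × ℝ^d`
    (∀ φ : ℝ → (Fin d → ℝ) → (Fin d → ℝ) → ℝ, IsTestXV d φ →
      (∃ a b : ℝ, 0 < a ∧ b < T ∧ ∀ t x v, (t ≤ a ∨ b ≤ t) → φ t x v = 0) →
      ∫ t in Ioo (0:ℝ) T, ∫ z, vlasovIntegrand d
          (fun t x => -gradx (fun y => Real.log (∑ j', ρ j' t y)) x) φ t
          (repT d z.1) z.2 ∂(f t) = 0) := by
  have hts : ∀ t : ℝ, ContDiff ℝ 1 fun x : Fin d → ℝ => (t, x) := fun t => by fun_prop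
  have hst : ∀ x : Fin d → ℝ, ContDiff ℝ 1 fun s : ℝ => (s, x) := fun x => by fun_prop
  have hρx : ∀ i t, ContDiff ℝ 1 (ρ i t) := fun i t => (hρC1 i).comp (hts t)
  have hux : ∀ i t, ContDiff ℝ 1 (u i t) := fun i t => (huC1 i).comp (hts t)
  have hρt : ∀ i x, ContDiff ℝ 1 (fun s => ρ i s x) := fun i x => (hρC1 i).comp (hst x)
  have hut : ∀ i x, ContDiff ℝ 1 (fun s => u i s x) := fun i x => (huC1 i).comp (hst x)
  refine ⟨fun t _ => ?_, ?_⟩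
  · rw [hf t]
    exact map_fst_sum_map_graph (fun i => (hρx i t).continuous) (fun i => (hux i t).continuous)
      fun i => hρnn i t
  rintro φ ⟨hφ, hφper, -⟩ ⟨a, b, ha, hb, hφ0⟩
  replace hφ := hφ.of_le (m := 1) (by exact_mod_cast le_top)
  set E : ℝ → (Fin d → ℝ) → (Fin d → ℝ) :=
    fun t x => -gradx (fun y => Real.log (∑ j', ρ j' t y)) x
  have hEc : ∀ t, Continuous (E t) := fun t => by
    have hlog : ContDiff ℝ 1 fun y => Real.log (∑ j', ρ j' t y) :=
      (ContDiff.sum fun i _ => hρx i t).log fun x => (hρpos t x).ne'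
    exact (continuous_pi fun k =>
      (hlog.continuous_fderiv one_ne_zero).clm_apply continuous_const).neg
  have hΦ : ∀ i, ContDiff ℝ 1 fun p : ℝ × (Fin d → ℝ) => φ p.1 p.2 (u i p.1 p.2) := fun i =>
    hφ.comp (contDiff_fst.prodMk (contDiff_snd.prodMk (huC1 i)))
  have hF : ∀ i, ContDiff ℝ 1 fun p : ℝ × (Fin d → ℝ) =>
    ρ i p.1 p.2 * φ p.1 p.2 (u i p.1 p.2) := fun i => (hρC1 i).mul (hΦ i)
  have hFc : ∀ i t, Continuous fun x =>
      deriv (fun s => ρ i s x * φ s x (u i s x)) t := fun i t => by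
    have hd : ∀ x, deriv (fun s => ρ i s x * φ s x (u i s x)) t
        = fderiv ℝ (fun p : ℝ × (Fin d → ℝ) => ρ i p.1 p.2 * φ p.1 p.2 (u i p.1 p.2)) (t, x)
          (1, 0) := fun x =>
      (HasFDerivAt.comp_hasDerivAt t (f := fun s => (s, x))
        ((hF i).differentiable one_ne_zero (t, x)).hasFDerivAt
        ((hasDerivAt_id t).prodMk (hasDerivAt_const t x))).deriv
    simp_rw [hd]
    exact (((hF i).continuous_fderiv one_ne_zero).comp (hts t).continuous).clm_apply
      continuous_const
  have hG : ∀ i t k, ContDiff ℝ 1 fun y => ρ i t y * u i t y k * φ t y (u i t y) :=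
    fun i t k => ((hρx i t).mul (contDiff_pi.1 (hux i t) k)).mul ((hΦ i).comp (hts t))
  have hGper : ∀ i t k, ZPeriodic fun y => ρ i t y * u i t y k * φ t y (u i t y) :=
    fun i t k x m => by
      simp only [hρper i t x m, huper i t x m]
      exact congrArg _ (hφper t (u i t x) x m)
  have hinner : ∀ t ∈ Ioo 0 T, ∫ z, vlasovIntegrand d E φ t (repT d z.1) z.2 ∂(f t)
      = ∫ x in Cube d, deriv (fun s => ∑ i, ρ i s x * φ s x (u i s x)) t := fun t ht => by
    have hV := continuous_vlasovIntegrand hφ (hEc t)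
    rw [hf t, integral_finsetSum_measure fun i _ => integrable_map_graph (hρx i t).continuous
      (hux i t).continuous (hρnn i t) hV]
    have hds : ∀ x, deriv (fun s => ∑ i, ρ i s x * φ s x (u i s x)) t
        = ∑ i, deriv (fun s => ρ i s x * φ s x (u i s x)) t := fun x =>
      deriv_fun_sum fun i _ => ((hF i).comp (hst x)).differentiable one_ne_zero t
    simp_rw [hds]
    rw [integral_finsetSum _ fun i _ => integrableOn_Cube (hFc i t)]
    refine Finset.sum_congr rfl fun i _ => ?_
    rw [integral_map_graph (hρx i t).continuous (hux i t).continuous (hρnn i t) hV]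
    have hpt : ∀ x, ρ i t x * vlasovIntegrand d E φ t x (u i t x)
        = deriv (fun s => ρ i s x * φ s x (u i s x)) t
          + ∑ k, fderiv ℝ (fun y => ρ i t y * u i t y k * φ t y (u i t y)) x (Pi.single k 1) :=
      fun x => mul_vlasovIntegrand_eq_divergence
        (W := fun t => gradx fun y => Real.log (∑ j', ρ j' t y))
        ((hρt i x).differentiable one_ne_zero t) ((hρx i t).differentiable one_ne_zero x)
        ((hut i x).differentiable one_ne_zero t) ((hux i t).differentiable one_ne_zero x)
        (hφ.differentiable one_ne_zero _) (heq1 i t (Ioo_subset_Icc_self ht) x)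
        (heq2 i t (Ioo_subset_Icc_self ht) x)
    simp_rw [hpt]
    rw [integral_add (integrableOn_Cube (hFc i t)) (integrableOn_Cube
      (continuous_finsetSum _ fun k _ =>
        ((hG i t k).continuous_fderiv one_ne_zero).clm_apply continuous_const)),
      integral_div_eq_zero hd (hG i t) (hGper i t), add_zero]
  rw [setIntegral_congr_fun measurableSet_Ioo hinner]
  refine integral_deriv_eq_zero hT.le (F := fun s x => ∑ i, ρ i s x * φ s x (u i s x))
    (ContDiff.sum fun i _ => hF i) (fun x => ?_) fun x => ?_
  · simp [hφ0 0 _ _ (Or.inl ha.le)]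
  · simp [hφ0 T _ _ (Or.inr hb.le)]
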